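/- (Simon) For every 0 < α ≤ 1, the L^1-norms of the one-dimensional Walsh–Kaczmarz (C,α) kernels are uniformly bounded: sup_{n ∈ N} ∫_G |K_n^{κ,α}(x)| dμ(x) < ∞. -/

import Mathlib

open MeasureTheory Filter Finset ENNReal

noncomputable section

/-- The Walsh group `G`: countable product of copies of `ℤ/2ℤ`. -/
abbrev WG : Type := ℕ → ZMod 2

/-- The normalized Haar measure (= product of uniform coin-toss measures) on `G`. -/
def μW : Measure WG := Measure.addHaarMeasure ⊤

instance : (μW).Regular := by unfold μW; infer_instance

instance : IsFiniteMeasure μW := by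
  constructor
  rw [← TopologicalSpace.PositiveCompacts.coe_top (α := WG)]
  exact IsCompact.measure_lt_top (⊤ : TopologicalSpace.PositiveCompacts WG).isCompact

/-- The product measure on `G^d`. -/
def μD (d : ℕ) : Measure (Fin d → WG) := Measure.pi fun _ => μW

/-- The `k`-th Rademacher function. -/
def rad (k : ℕ) (x : WG) : ℝ := (-1 : ℝ) ^ (x k).val

/-- The Walsh–Paley function of index `n`. -/
def walsh (n : ℕ) (x : WG) : ℝ :=
  ∏ k ∈ Finset.range n.size, if n.testBit k then rad k x else 1

/-- The Walsh–Kaczmarz function of index `n`; `Nat.log 2 n` is the order `|n|`. -/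
def kacz (n : ℕ) (x : WG) : ℝ :=
  if n = 0 then 1 else
    rad (Nat.log 2 n) x *
      (-1 : ℝ) ^ (∑ k ∈ Finset.range (Nat.log 2 n),
        (if n.testBit k then 1 else 0) * (x (Nat.log 2 n - 1 - k)).val)

/-- The `d`-dimensional Walsh–Kaczmarz function. -/
def kaczD (d : ℕ) (m : Fin d → ℕ) (x : Fin d → WG) : ℝ := ∏ i, kacz (m i) (x i)

/-- Walsh–Paley Dirichlet kernel. -/
def dirW (n : ℕ) (x : WG) : ℝ := ∑ k ∈ Finset.range n, walsh k x

/-- Walsh–Kaczmarz Dirichlet kernel. -/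
def dirK (n : ℕ) (x : WG) : ℝ := ∑ k ∈ Finset.range n, kacz k x

/-- `A_j^α = binom (j+α) j`. -/
def Abin (α : ℝ) (j : ℕ) : ℝ := ∏ i ∈ Finset.range j, (α + i + 1) / (i + 1)

/-- One-dimensional Walsh–Paley `(C,α)` kernel. -/
def KW (α : ℝ) (n : ℕ) (x : WG) : ℝ :=
  (Abin α n)⁻¹ * ∑ k ∈ Finset.range (n + 1), Abin (α - 1) (n - k) * dirW k x

/-- One-dimensional Walsh–Kaczmarz `(C,α)` kernel. -/
def KK (α : ℝ) (n : ℕ) (x : WG) : ℝ :=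
  (Abin α n)⁻¹ * ∑ k ∈ Finset.range (n + 1), Abin (α - 1) (n - k) * dirK k x

/-- The `m`-th Walsh–Kaczmarz–Fourier coefficient of `f : G^d → ℝ`. -/
def fCoeff (d : ℕ) (f : (Fin d → WG) → ℝ) (m : Fin d → ℕ) : ℝ :=
  ∫ x, f x * kaczD d m x ∂ μD d

/-- Rectangular partial sum built from an abstract family `c` of Fourier coefficients. -/
def partialSumOf (d : ℕ) (c : (Fin d → ℕ) → ℝ) (k : Fin d → ℕ) (x : Fin d → WG) : ℝ :=
  ∑ m ∈ Fintype.piFinset (fun i => Finset.range (k i)), c m * kaczD d m x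

/-- `(C,α)` (Cesàro) mean of order `n` built from coefficients `c`. -/
def cesaroOf (d : ℕ) (α : Fin d → ℝ) (c : (Fin d → ℕ) → ℝ) (n : Fin d → ℕ)
    (x : Fin d → WG) : ℝ :=
  (∏ i, Abin (α i) (n i))⁻¹ *
    ∑ k ∈ Fintype.piFinset (fun i => Finset.range (n i + 1)),
      (∏ i, Abin (α i - 1) (n i - k i)) * partialSumOf d c k x

/-- A cone-like restriction function (CRF) family `γ = (γ_j)_{j ≠ 0}`. -/
structure IsCRF (d : ℕ) [NeZero d] (γ : Fin d → ℝ → ℝ) : Prop where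
  strictMono : ∀ j : Fin d, j ≠ 0 → StrictMonoOn (γ j) (Set.Ici 1)
  contOn : ∀ j : Fin d, j ≠ 0 → ContinuousOn (γ j) (Set.Ici 1)
  one_le : ∀ j : Fin d, j ≠ 0 → ∀ x : ℝ, 1 ≤ x → 1 ≤ γ j x
  map_one : ∀ j : Fin d, j ≠ 0 → γ j 1 = 1
  tendsto_atTop : ∀ j : Fin d, j ≠ 0 → Tendsto (γ j) atTop atTop
  reg : ∃ ζ : ℝ, 1 < ζ ∧ ∀ j : Fin d, j ≠ 0 → ∃ c₁ c₂ : ℝ, 1 < c₁ ∧ 1 < c₂ ∧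
    ∀ x : ℝ, 1 ≤ x → c₁ * γ j x ≤ γ j (ζ * x) ∧ γ j (ζ * x) ≤ c₂ * γ j x

/-- The cone-like set `L` determined by `γ` and the parameters `β`. -/
def coneLike (d : ℕ) [NeZero d] (γ : Fin d → ℝ → ℝ) (β : Fin d → ℝ) : Set (Fin d → ℕ) :=
  {n | ∀ j : Fin d, j ≠ 0 → (β j)⁻¹ * γ j (n 0) ≤ (n j : ℝ) ∧ (n j : ℝ) ≤ β j * γ j (n 0)}

/-- `bar γ n₁ = (n₁, n₂, …, n_d)` where `n_j = |γ_j(2^{n₁})|` is the order of `γ_j(2^{n₁})`,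
i.e. `2^{n_j} ≤ γ_j(2^{n₁}) < 2^{n_j+1}`. -/
def bar (d : ℕ) [NeZero d] (γ : Fin d → ℝ → ℝ) (n₁ : ℕ) : Fin d → ℕ :=
  fun j => if j = 0 then n₁ else Nat.log 2 ⌊γ j ((2 : ℝ) ^ n₁)⌋₊

/-- The cone-like restricted maximal operator `σ_L^{κ,α,*}` (built from coefficients `c`). -/
def cesaroMaximal (d : ℕ) [NeZero d] (α : Fin d → ℝ) (γ : Fin d → ℝ → ℝ) (β : Fin d → ℝ)
    (c : (Fin d → ℕ) → ℝ) (x : Fin d → WG) : ℝ≥0∞ :=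
  ⨆ n ∈ coneLike d γ β, ENNReal.ofReal |cesaroOf d α c n x|

/-- `L^p`-"norm" (`0 < p < ∞`) of an `ℝ≥0∞`-valued function on `G^d`. -/
def lpNormE (d : ℕ) (p : ℝ) (g : (Fin d → WG) → ℝ≥0∞) : ℝ≥0∞ :=
  (∫⁻ x, g x ^ p ∂ μD d) ^ (1 / p)

/-- The dyadic rectangle `I_{N}(y) = I_{N_1}(y^1) × ⋯ × I_{N_d}(y^d)`. -/
def rectAt (d : ℕ) (N : Fin d → ℕ) (y : Fin d → WG) : Set (Fin d → WG) :=
  {x | ∀ j : Fin d, ∀ i : ℕ, i < N j → x j i = y j i}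

/-- The one-dimensional dyadic interval `I_N = I_N(0)`. -/
def rectW (N : ℕ) : Set WG := {x | ∀ i : ℕ, i < N → x i = 0}

/-- A one-parameter martingale with respect to the filtration
`(F_{bar γ n₁})_{n₁}` generated by the dyadic rectangles `I_{bar γ n₁}(y)`
(measurability w.r.t. this atomic σ-algebra = being constant on its rectangles,
and the martingale property = equality of integrals over the rectangles). -/
structure ConeMartingale (d : ℕ) [NeZero d] (γ : Fin d → ℝ → ℝ) where
  F : ℕ → (Fin d → WG) → ℝ
  integrable : ∀ n₁, Integrable (F n₁) (μD d)
  adapted : ∀ n₁ (x y : Fin d → WG),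
    (∀ j : Fin d, ∀ i : ℕ, i < bar d γ n₁ j → x j i = y j i) → F n₁ x = F n₁ y
  mart : ∀ n₁ m₁, n₁ ≤ m₁ → ∀ y,
    ∫ x in rectAt d (bar d γ n₁) y, F m₁ x ∂ μD d
      = ∫ x in rectAt d (bar d γ n₁) y, F n₁ x ∂ μD d

/-- The Fourier coefficients of a martingale (the integrals `∫ f_k ψ_m` stabilize). -/
def martCoeff (d : ℕ) [NeZero d] (γ : Fin d → ℝ → ℝ) (f : ConeMartingale d γ) (m : Fin d → ℕ) : ℝ :=
  limUnder atTop (fun k => ∫ x, f.F k x * kaczD d m x ∂ μD d)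

/-- The maximal function `f* = sup_{n₁} |f_{bar n₁}|` of a martingale. -/
def martMaximal (d : ℕ) [NeZero d] (γ : Fin d → ℝ → ℝ) (f : ConeMartingale d γ)
    (x : Fin d → WG) : ℝ≥0∞ :=
  ⨆ n₁ : ℕ, ENNReal.ofReal |f.F n₁ x|

/-- The martingale Hardy space "norm" `‖f‖_{H_p^γ} = ‖f*‖_p`. -/
def hardyNorm (d : ℕ) [NeZero d] (γ : Fin d → ℝ → ℝ) (p : ℝ) (f : ConeMartingale d γ) : ℝ≥0∞ :=
  lpNormE d p (martMaximal d γ f)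

/-- A `p`-atom supported on the rectangle `I_N(y)`. -/
structure IsPAtom (d : ℕ) (p : ℝ) (a : (Fin d → WG) → ℝ) (N : Fin d → ℕ)
    (y : Fin d → WG) : Prop where
  measurable : Measurable a
  support : ∀ x, x ∉ rectAt d N y → a x = 0
  bound : ∀ x, |a x| ≤ ((μD d (rectAt d N y)).toReal) ^ (-(1 / p))
  zero : ∫ x, a x ∂ μD d = 0

/-- The conditional-expectation (dyadic average) of `f` at level `N`. -/
def avgAt (d : ℕ) (N : Fin d → ℕ) (f : (Fin d → WG) → ℝ) (x : Fin d → WG) : ℝ :=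
  (2 : ℝ) ^ (∑ j, N j) * ∫ t in rectAt d N x, f t ∂ μD d

/-- `m` is the martingale generated by the integrable function `f`. -/
def inducedLevels (d : ℕ) [NeZero d] (γ : Fin d → ℝ → ℝ) (f : (Fin d → WG) → ℝ)
    (m : ConeMartingale d γ) : Prop :=
  ∀ n₁ x, m.F n₁ x = avgAt d (bar d γ n₁) f x

/-- The martingale maximal function of (the martingale generated by) a function `f`,
`f* = sup_{n₁} |S_{2^{bar γ n₁}} f|`. -/
def funMaximal (d : ℕ) [NeZero d] (γ : Fin d → ℝ → ℝ) (f : (Fin d → WG) → ℝ)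
    (x : Fin d → WG) : ℝ≥0∞ :=
  ⨆ n₁ : ℕ, ENNReal.ofReal |partialSumOf d (fCoeff d f) (fun j => 2 ^ bar d γ n₁ j) x|

/-- The Hardy norm `‖f‖_{H_p^γ}` of (the martingale generated by) a function `f`. -/
def funHardyNorm (d : ℕ) [NeZero d] (γ : Fin d → ℝ → ℝ) (p : ℝ) (f : (Fin d → WG) → ℝ) : ℝ≥0∞ :=
  lpNormE d p (funMaximal d γ f)

/-- Skvortsov's bit-reversal transformation `τ_A`. -/
def tau (A : ℕ) (x : WG) : WG := fun i => if i < A then x (A - 1 - i) else x i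

end

noncomputable section

section Measure

lemma μW_univ : μW Set.univ = 1 := by
  rw [← TopologicalSpace.PositiveCompacts.coe_top (α := WG)]
  exact Measure.addHaarMeasure_self

instance : Measure.IsAddHaarMeasure μW := by unfold μW; infer_instance

lemma integrable_of_continuous {f : WG → ℝ} (hf : Continuous f) : Integrable f μW := by
  simpa using hf.continuousOn.integrableOn_compact (μ := μW) isCompact_univ

lemma continuous_tau (A : ℕ) : Continuous (tau A) := by
  refine continuous_pi fun i => ?_
  unfold tau
  split_ifs <;> exact continuous_apply _

lemma tau_tau (A : ℕ) (x : WG) : tau A (tau A x) = x := by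
  funext i
  unfold tau
  by_cases h : i < A
  · have h1 : A - 1 - i < A := by omega
    have h2 : A - 1 - (A - 1 - i) = i := by omega
    simp [h, h1, h2]
  · simp [h]

lemma measurePreserving_tau (A : ℕ) : MeasurePreserving (tau A) μW μW := by
  let f : WG →+ WG :=
    { toFun := tau A
      map_zero' := by funext i; simp [tau]
      map_add' := by intro x y; funext i; simp only [tau, Pi.add_apply]; split_ifs <;> rfl }
  exact AddMonoidHom.measurePreserving (f := f) (continuous_tau A)
    (fun x => ⟨tau A x, tau_tau A x⟩) rfl

lemma integral_comp_tau (A : ℕ) {f : WG → ℝ} (hf : Continuous f) :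
    ∫ x, f (tau A x) ∂μW = ∫ x, f x ∂μW := by
  conv_rhs => rw [← (measurePreserving_tau A).map_eq]
  rw [integral_map (continuous_tau A).aemeasurable hf.aestronglyMeasurable]

@[fun_prop]
lemma continuous_rad (k : ℕ) : Continuous (rad k) :=
  (continuous_of_discreteTopology (f := fun z : ZMod 2 => (-1 : ℝ) ^ z.val)).comp
    (continuous_apply k)

lemma abs_rad (k : ℕ) (x : WG) : |rad k x| = 1 := by simp [rad, abs_pow]

lemma neg_one_le_rad (k : ℕ) (x : WG) : -1 ≤ rad k x := (abs_le.1 (abs_rad k x).le).1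

lemma rad_add_single_self (m : ℕ) (x : WG) : rad m (x + Pi.single m 1) = -rad m x := by
  have h : ∀ z : ZMod 2, (-1 : ℝ) ^ (z + 1).val = -(-1 : ℝ) ^ z.val := by
    intro z
    fin_cases z
    · change (-1 : ℝ) ^ 1 = -(-1 : ℝ) ^ 0
      norm_num
    · change (-1 : ℝ) ^ 0 = -(-1 : ℝ) ^ 1
      norm_num
  simpa [rad] using h (x m)

lemma rad_add_single_of_ne {k m : ℕ} (h : k ≠ m) (x : WG) :
    rad k (x + Pi.single m 1) = rad k x := by
  simp [rad, h]

lemma integral_mul_one_add_rad {g : WG → ℝ} (hg : Continuous g) (m : ℕ)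
    (hm : ∀ x, g (x + Pi.single m 1) = g x) :
    ∫ x, g x * (1 + rad m x) ∂μW = ∫ x, g x ∂μW := by
  have h0 : ∫ x, g x * rad m x ∂μW = 0 := by
    have h1 := integral_add_right_eq_self (μ := μW) (fun x => g x * rad m x) (Pi.single m 1)
    simp only [hm, rad_add_single_self, mul_neg, integral_neg] at h1
    linarith
  simp only [mul_add, mul_one]
  rw [integral_add (integrable_of_continuous hg) (integrable_of_continuous (by fun_prop)), h0,
    add_zero]

end Measure

section Seminorm

/-- The `L¹`-seminorm of a real function on the Walsh group. -/
def l1 (f : WG → ℝ) : ℝ := ∫ x, |f x| ∂μW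

lemma l1_add_le {f g : WG → ℝ} (hf : Continuous f) (hg : Continuous g) :
    l1 (fun x => f x + g x) ≤ l1 f + l1 g := by
  unfold l1
  rw [← integral_add (integrable_of_continuous hf.abs) (integrable_of_continuous hg.abs)]
  exact integral_mono (integrable_of_continuous (by fun_prop))
    (integrable_of_continuous (by fun_prop)) fun x => abs_add_le _ _

lemma l1_const_mul (c : ℝ) (f : WG → ℝ) : l1 (fun x => c * f x) = |c| * l1 f := by
  simp only [l1, abs_mul, integral_const_mul]

lemma l1_mul_of_abs_eq_one {u : WG → ℝ} (hu : ∀ x, |u x| = 1) (f : WG → ℝ) :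
    l1 (fun x => u x * f x) = l1 f := by
  simp only [l1, abs_mul, hu, one_mul]

lemma l1_comp_tau (A : ℕ) {f : WG → ℝ} (hf : Continuous f) :
    l1 (fun x => f (tau A x)) = l1 f :=
  integral_comp_tau A hf.abs

lemma l1_const (c : ℝ) : l1 (fun _ => c) = |c| := by
  simp [l1, Measure.real, μW_univ]

end Seminorm

section Walsh

lemma walsh_eq_prod {n M : ℕ} (h : n < 2 ^ M) (x : WG) :
    walsh n x = ∏ k ∈ Finset.range M, if n.testBit k then rad k x else 1 := by
  unfold walsh
  apply Finset.prod_subset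
  · exact Finset.range_subset_range.2 (Nat.size_le.2 h)
  · intro k _ hk
    rw [Finset.mem_range, not_lt] at hk
    have : n.testBit k = false :=
      Nat.testBit_lt_two_pow (lt_of_lt_of_le (Nat.lt_size_self n) (Nat.pow_le_pow_right (by simp) hk))
    simp [this]

@[fun_prop]
lemma continuous_walsh (n : ℕ) : Continuous (walsh n) := by
  unfold walsh
  refine continuous_finsetProd _ fun k _ => ?_
  split_ifs <;> fun_prop

@[fun_prop]
lemma continuous_dirW (n : ℕ) : Continuous (dirW n) := by
  unfold dirW
  fun_prop

lemma abs_walsh (n : ℕ) (x : WG) : |walsh n x| = 1 := by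
  rw [walsh, Finset.abs_prod]
  refine Finset.prod_eq_one fun k _ => ?_
  split_ifs <;> simp [abs_rad]

lemma walsh_zero (x : WG) : walsh 0 x = 1 := by simp [walsh]

lemma walsh_two_pow_add {m i : ℕ} (h : i < 2 ^ m) (x : WG) :
    walsh (2 ^ m + i) x = rad m x * walsh i x := by
  rw [walsh_eq_prod (M := m + 1) (by rw [pow_succ]; omega), walsh_eq_prod h,
    Finset.prod_range_succ, mul_comm, Nat.testBit_two_pow_add_eq, Nat.testBit_lt_two_pow h]
  simp only [Bool.not_false, if_true]
  congr 1
  refine Finset.prod_congr rfl fun k hk => ?_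
  rw [Nat.testBit_two_pow_add_gt (Finset.mem_range.1 hk)]

lemma walsh_reflect {m i : ℕ} (h : i < 2 ^ m) (x : WG) :
    walsh (2 ^ m - 1 - i) x = walsh (2 ^ m - 1) x * walsh i x := by
  rw [walsh_eq_prod (M := m) (by omega), walsh_eq_prod (M := m) (n := 2 ^ m - 1) (by omega),
    walsh_eq_prod h, ← Finset.prod_mul_distrib]
  refine Finset.prod_congr rfl fun k hk => ?_
  have hk' := Finset.mem_range.1 hk
  have hr : rad k x * rad k x = 1 := by
    rw [← abs_mul_abs_self, abs_rad, one_mul]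
  rw [show 2 ^ m - 1 - i = 2 ^ m - (i + 1) by omega, Nat.testBit_two_pow_sub_succ h,
    Nat.testBit_two_pow_sub_one]
  cases i.testBit k <;> simp [hk', hr]

lemma rad_tau {m k : ℕ} (h : k < m) (x : WG) : rad k (tau m x) = rad (m - 1 - k) x := by
  simp [rad, tau, h]

lemma kacz_zero (x : WG) : kacz 0 x = 1 := by simp [kacz]

lemma kacz_two_pow_add {m i : ℕ} (h : i < 2 ^ m) (x : WG) :
    kacz (2 ^ m + i) x = rad m x * walsh i (tau m x) := by
  have hlog : Nat.log 2 (2 ^ m + i) = m :=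
    (Nat.log_eq_iff (Or.inr ⟨by norm_num, by positivity⟩)).2
      ⟨by omega, by rw [pow_succ]; omega⟩
  have h0 : 2 ^ m + i ≠ 0 := by positivity
  rw [kacz, if_neg h0, hlog, ← Finset.prod_pow_eq_pow_sum, walsh_eq_prod h]
  congr 1
  refine Finset.prod_congr rfl fun k hk => ?_
  have hk' := Finset.mem_range.1 hk
  rw [Nat.testBit_two_pow_add_gt hk', rad_tau hk']
  cases i.testBit k <;> simp [rad]

@[fun_prop]
lemma continuous_kacz (n : ℕ) : Continuous (kacz n) := by
  unfold kacz
  split_ifs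
  · fun_prop
  · simp only [← Finset.prod_pow_eq_pow_sum, mul_comm _ (ZMod.val _), pow_mul]
    refine (continuous_rad _).mul (continuous_finsetProd _ fun k _ => ?_)
    exact (continuous_rad _).pow _

end Walsh

section Dirichlet

/-- The Riesz product `∏_{k<m} (1 + r_k)`, the Dirichlet kernel of order `2 ^ m`. -/
def dirPow (m : ℕ) (x : WG) : ℝ := ∏ k ∈ Finset.range m, (1 + rad k x)

@[fun_prop]
lemma continuous_dirPow (m : ℕ) : Continuous (dirPow m) := by
  unfold dirPow
  fun_prop

lemma dirPow_succ (m : ℕ) (x : WG) : dirPow (m + 1) x = dirPow m x * (1 + rad m x) :=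
  Finset.prod_range_succ _ _

lemma dirPow_nonneg (m : ℕ) (x : WG) : 0 ≤ dirPow m x :=
  Finset.prod_nonneg fun k _ => by linarith [neg_one_le_rad k x]

lemma dirPow_tau (m : ℕ) (x : WG) : dirPow m (tau m x) = dirPow m x := by
  unfold dirPow
  rw [← Finset.prod_range_reflect (fun k => 1 + rad k x)]
  exact Finset.prod_congr rfl fun k hk => by rw [rad_tau (Finset.mem_range.1 hk)]

lemma l1_dirPow (m : ℕ) : l1 (dirPow m) = 1 := by
  simp only [l1, abs_of_nonneg (dirPow_nonneg _ _)]
  induction m with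
  | zero => simp [dirPow, Measure.real, μW_univ]
  | succ m ih =>
    simp only [dirPow_succ]
    rw [integral_mul_one_add_rad (by fun_prop) m, ih]
    intro x
    exact Finset.prod_congr rfl fun k hk => by
      rw [rad_add_single_of_ne (Finset.mem_range.1 hk).ne]

lemma dirW_two_pow_add {m i : ℕ} (h : i ≤ 2 ^ m) (x : WG) :
    dirW (2 ^ m + i) x = dirW (2 ^ m) x + rad m x * dirW i x := by
  unfold dirW
  rw [Finset.sum_range_add, Finset.mul_sum]
  congr 1
  exact Finset.sum_congr rfl fun k hk =>
    walsh_two_pow_add (lt_of_lt_of_le (Finset.mem_range.1 hk) h) x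

lemma dirW_two_pow (m : ℕ) (x : WG) : dirW (2 ^ m) x = dirPow m x := by
  induction m with
  | zero => simp [dirW, dirPow, walsh_zero]
  | succ m ih =>
    rw [pow_succ, mul_two, dirW_two_pow_add le_rfl, dirPow_succ, ih]
    ring

lemma walsh_mul_dirPow (m : ℕ) (x : WG) :
    walsh (2 ^ m - 1) x * dirPow m x = dirPow m x := by
  rw [← dirW_two_pow, dirW, Finset.mul_sum]
  conv_rhs => rw [← Finset.sum_range_reflect]
  exact Finset.sum_congr rfl fun k hk => (walsh_reflect (Finset.mem_range.1 hk) x).symm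

end Dirichlet

section Fejer

/-- The unnormalized Walsh–Fejér kernel `D_1 + ⋯ + D_n`. -/
def fejerSum (n : ℕ) (x : WG) : ℝ := ∑ k ∈ Finset.range n, dirW (k + 1) x

@[fun_prop]
lemma continuous_fejerSum (n : ℕ) : Continuous (fejerSum n) := by
  unfold fejerSum
  fun_prop

lemma fejerSum_two_pow_add {m i : ℕ} (h : i ≤ 2 ^ m) (x : WG) :
    fejerSum (2 ^ m + i) x = fejerSum (2 ^ m) x + i * dirPow m x + rad m x * fejerSum i x := by
  unfold fejerSum
  rw [Finset.sum_range_add, Finset.mul_sum, add_assoc]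
  congr 1
  have : (i : ℝ) * dirPow m x = ∑ k ∈ Finset.range i, dirPow m x := by simp
  rw [this, ← Finset.sum_add_distrib]
  refine Finset.sum_congr rfl fun k hk => ?_
  have hk := Finset.mem_range.1 hk
  rw [add_assoc, dirW_two_pow_add (by omega), dirW_two_pow]

lemma walsh_add_single {m i : ℕ} (h : i < 2 ^ m) (x : WG) :
    walsh i (x + Pi.single m 1) = walsh i x := by
  rw [walsh_eq_prod h, walsh_eq_prod h]
  exact Finset.prod_congr rfl fun k hk => by
    rw [rad_add_single_of_ne (Finset.mem_range.1 hk).ne]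

lemma fejerSum_add_single (m : ℕ) (x : WG) :
    fejerSum (2 ^ m) (x + Pi.single m 1) = fejerSum (2 ^ m) x := by
  refine Finset.sum_congr rfl fun k hk => Finset.sum_congr rfl fun i hi => ?_
  have hk := Finset.mem_range.1 hk
  have hi := Finset.mem_range.1 hi
  exact walsh_add_single (by omega) x

lemma l1_fejerSum_two_pow (m : ℕ) : l1 (fejerSum (2 ^ m)) ≤ 2 ^ m := by
  induction m with
  | zero => simp [l1, fejerSum, dirW, walsh_zero, Measure.real, μW_univ]
  | succ m ih =>
    have e : fejerSum (2 ^ (m + 1)) =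
        fun x => fejerSum (2 ^ m) x * (1 + rad m x) + 2 ^ m * dirPow m x := by
      funext x
      rw [pow_succ, mul_two, fejerSum_two_pow_add le_rfl]
      push_cast
      ring
    have h1 : l1 (fun x => fejerSum (2 ^ m) x * (1 + rad m x)) = l1 (fejerSum (2 ^ m)) := by
      unfold l1
      rw [← integral_mul_one_add_rad (g := fun x => |fejerSum (2 ^ m) x|) (by fun_prop) m
        (fun x => by rw [fejerSum_add_single])]
      congr 1 with x
      rw [abs_mul, abs_of_nonneg (a := 1 + rad m x) (by linarith [neg_one_le_rad m x])]
    rw [e]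
    refine (l1_add_le (by fun_prop) (by fun_prop)).trans ?_
    rw [h1, l1_const_mul, l1_dirPow, abs_of_nonneg (by positivity), pow_succ]
    linarith

lemma exists_two_pow_add {n : ℕ} (hn : n ≠ 0) : ∃ m i, i < 2 ^ m ∧ n = 2 ^ m + i := by
  have h1 := Nat.pow_log_le_self 2 hn
  have h2 := Nat.lt_pow_succ_log_self (b := 2) (by norm_num) n
  rw [pow_succ] at h2
  exact ⟨Nat.log 2 n, n - 2 ^ Nat.log 2 n, by omega, by omega⟩

lemma l1_fejerSum_le (n : ℕ) : l1 (fejerSum n) ≤ 2 * n := by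
  induction n using Nat.strong_induction_on with
  | _ n ih =>
  rcases eq_or_ne n 0 with rfl | hn
  · simp [l1, fejerSum]
  obtain ⟨m, i, hi, rfl⟩ := exists_two_pow_add hn
  have e : fejerSum (2 ^ m + i) = fun x =>
      (fejerSum (2 ^ m) x + i * dirPow m x) + rad m x * fejerSum i x :=
    funext (fejerSum_two_pow_add hi.le)
  have h1 := l1_fejerSum_two_pow m
  have h2 := ih i (by omega)
  have h3 : (i : ℝ) ≤ 2 ^ m := by exact_mod_cast hi.le
  rw [e]
  refine (l1_add_le (by fun_prop) (by fun_prop)).trans ?_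
  refine (add_le_add_left (l1_add_le (by fun_prop) (by fun_prop)) _).trans ?_
  rw [l1_const_mul, l1_dirPow, l1_mul_of_abs_eq_one (abs_rad m), Nat.abs_cast]
  push_cast
  linarith

lemma l1_sum_antitone_mul_dirW_le {b : ℕ → ℝ} (hb : Antitone b) (hb0 : ∀ i, 0 ≤ b i) (K : ℕ) :
    l1 (fun x => ∑ i ∈ Finset.range K, b i * dirW (i + 1) x) ≤
      2 * ∑ i ∈ Finset.range K, b i := by
  have key : l1 (fun x => ∑ i ∈ Finset.range K, b i * dirW (i + 1) x - b K * fejerSum K x) ≤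
      2 * (∑ i ∈ Finset.range K, b i - K * b K) := by
    induction K with
    | zero => simp [l1, fejerSum]
    | succ K ih =>
      have e : (fun x => ∑ i ∈ Finset.range (K + 1), b i * dirW (i + 1) x -
          b (K + 1) * fejerSum (K + 1) x) = fun x =>
          (∑ i ∈ Finset.range K, b i * dirW (i + 1) x - b K * fejerSum K x) +
            (b K - b (K + 1)) * fejerSum (K + 1) x := by
        funext x
        simp only [fejerSum, Finset.sum_range_succ]
        ring
      have hd : 0 ≤ b K - b (K + 1) := sub_nonneg.2 (hb K.le_succ)
      have h2 := mul_le_mul_of_nonneg_left (l1_fejerSum_le (K + 1)) hd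
      rw [e]
      refine (l1_add_le (by fun_prop) (by fun_prop)).trans ?_
      rw [l1_const_mul, abs_of_nonneg hd, Finset.sum_range_succ]
      push_cast at h2 ⊢
      linarith
  have e : (fun x => ∑ i ∈ Finset.range K, b i * dirW (i + 1) x) = fun x =>
      (∑ i ∈ Finset.range K, b i * dirW (i + 1) x - b K * fejerSum K x) +
        b K * fejerSum K x := by
    funext x
    ring
  have h2 := mul_le_mul_of_nonneg_left (l1_fejerSum_le K) (hb0 K)
  rw [e]
  refine (l1_add_le (by fun_prop) (by fun_prop)).trans ?_
  rw [l1_const_mul, abs_of_nonneg (hb0 K)]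
  linarith

end Fejer

section Binomial

variable {α : ℝ}

lemma Abin_zero (β : ℝ) : Abin β 0 = 1 := by simp [Abin]

lemma Abin_succ (β : ℝ) (j : ℕ) : Abin β (j + 1) = Abin β j * ((β + j + 1) / (j + 1)) :=
  Finset.prod_range_succ _ _

lemma Abin_pos {β : ℝ} (hβ : -1 < β) (j : ℕ) : 0 < Abin β j :=
  Finset.prod_pos fun i _ => div_pos (by linarith [(Nat.cast_nonneg i : (0 : ℝ) ≤ i)]) (by positivity)

lemma Abin_sub_one_succ (β : ℝ) (j : ℕ) :
    Abin (β - 1) (j + 1) = Abin β (j + 1) - Abin β j := by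
  have key : ∀ j : ℕ, Abin (β - 1) (j + 1) * (j + 1) = Abin β j * β := by
    intro j
    induction j with
    | zero => simp [Abin]
    | succ j ih =>
      rw [Abin_succ (β - 1) (j + 1), Abin_succ β j]
      have h : (j : ℝ) + 1 ≠ 0 := by positivity
      have h' : (j : ℝ) + 1 + 1 ≠ 0 := by positivity
      push_cast
      field_simp
      linear_combination (β + j + 1) * ih
  have h : (j : ℝ) + 1 ≠ 0 := by positivity
  rw [Abin_succ β j]
  field_simp
  linear_combination key j

lemma Abin_monotone (hα : 0 < α) : Monotone (Abin α) :=
  monotone_nat_of_le_succ fun j => by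
    linarith [Abin_sub_one_succ α j, Abin_pos (β := α - 1) (by linarith) (j + 1)]

lemma Abin_sub_one_antitone (hα : 0 < α) (hα1 : α ≤ 1) : Antitone (Abin (α - 1)) :=
  antitone_nat_of_succ_le fun j => by
    rw [Abin_succ]
    refine mul_le_of_le_one_right (Abin_pos (by linarith) j).le ?_
    rw [div_le_one (by positivity)]
    linarith

lemma sum_Abin_sub_one (β : ℝ) (q K : ℕ) :
    ∑ i ∈ Finset.range K, Abin (β - 1) (q + i + 1) = Abin β (q + K) - Abin β q := by
  simp only [Abin_sub_one_succ]
  exact Finset.sum_range_sub (fun i => Abin β (q + i)) K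

lemma one_add_half_mul_Abin_le (hα : 0 < α) (j : ℕ) :
    (1 + α / 2) * Abin α j ≤ Abin α (2 * j + 1) := by
  have key : ∀ i ≤ j + 1, (1 + i * (α / (2 * (j + 1)))) * Abin α j ≤ Abin α (j + i) := by
    intro i
    induction i with
    | zero => intro _; simp
    | succ i ih =>
      intro hi
      have h1 := ih (by omega)
      have hA := Abin_pos (β := α) (by linarith) j
      have hm := Abin_monotone hα (Nat.le_add_right j i)
      have hr : α / (2 * (j + 1)) ≤ α / (j + i + 1) := by
        refine div_le_div_of_nonneg_left hα.le (by positivity) ?_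
        have : ((i + 1 : ℕ) : ℝ) ≤ ((j + 1 : ℕ) : ℝ) := by exact_mod_cast hi
        push_cast at this
        linarith
      have e : Abin α (j + (i + 1)) = Abin α (j + i) + Abin α (j + i) * (α / (j + i + 1)) := by
        rw [← add_assoc, Abin_succ]
        have : (j : ℝ) + i + 1 ≠ 0 := by positivity
        push_cast
        field_simp
        ring
      have h2 : Abin α j * (α / (2 * (j + 1))) ≤ Abin α (j + i) * (α / (j + i + 1)) :=
        mul_le_mul hm hr (by positivity) (Abin_pos (by linarith) _).le
      rw [e]
      push_cast
      linarith
  have h := key (j + 1) le_rfl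
  have e : ((j + 1 : ℕ) : ℝ) * (α / (2 * (j + 1))) = α / 2 := by
    push_cast
    field_simp
  rwa [e, ← add_assoc, ← two_mul] at h

end Binomial

section Cesaro

variable {α : ℝ}

lemma sum_mul_walsh_eq (β : ℝ) (q K : ℕ) (x : WG) :
    ∑ i ∈ Finset.range (K + 1), Abin β (q + i) * walsh i x =
      Abin β (q + K) * dirW (K + 1) x -
        ∑ i ∈ Finset.range K, Abin (β - 1) (q + i + 1) * dirW (i + 1) x := by
  induction K with
  | zero => simp [dirW]
  | succ K ih =>
    rw [Finset.sum_range_succ, ih, Finset.sum_range_succ _ K, Abin_sub_one_succ,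
      dirW, dirW, Finset.sum_range_succ _ (K + 1)]
    ring_nf

/-- The remainder in the summation by parts of a dyadic block of the Cesàro kernel. -/
def blockRem (α : ℝ) (m q : ℕ) (x : WG) : ℝ :=
  walsh (2 ^ m - 1) x *
    ∑ i ∈ Finset.range (2 ^ m - 1), Abin (α - 1) (q + i + 1) * dirW (i + 1) x

@[fun_prop]
lemma continuous_blockRem (m q : ℕ) : Continuous (blockRem α m q) := by
  unfold blockRem
  fun_prop

lemma sum_block_eq (m q : ℕ) (x : WG) :
    ∑ i ∈ Finset.range (2 ^ m), Abin α (q + (2 ^ m - 1 - i)) * walsh i x =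
      Abin α (q + (2 ^ m - 1)) * dirPow m x - blockRem α m q x := by
  have hpos : 0 < 2 ^ m := by positivity
  have h := sum_mul_walsh_eq α q (2 ^ m - 1) x
  rw [Nat.sub_add_cancel hpos, dirW_two_pow] at h
  rw [← Finset.sum_range_reflect, blockRem, ← walsh_mul_dirPow m x]
  calc _ = walsh (2 ^ m - 1) x *
        ∑ i ∈ Finset.range (2 ^ m), Abin α (q + i) * walsh i x := by
        rw [Finset.mul_sum]
        refine Finset.sum_congr rfl fun i hi => ?_
        have hi := Finset.mem_range.1 hi
        rw [walsh_reflect hi, show 2 ^ m - 1 - (2 ^ m - 1 - i) = i by omega]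
        ring
    _ = _ := by rw [h, ← walsh_mul_dirPow m x]; ring_nf

lemma l1_blockRem_le (hα : 0 < α) (hα1 : α ≤ 1) (m q : ℕ) :
    l1 (blockRem α m q) ≤ 2 * (Abin α (q + (2 ^ m - 1)) - Abin α q) := by
  unfold blockRem
  rw [l1_mul_of_abs_eq_one (abs_walsh _), ← sum_Abin_sub_one]
  exact l1_sum_antitone_mul_dirW_le (b := fun i => Abin (α - 1) (q + i + 1))
    (fun i j h => Abin_sub_one_antitone hα hα1 (by omega))
    (fun i => (Abin_pos (by linarith) _).le) _

/-- The unnormalized Walsh–Paley Cesàro kernel. -/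
def cesaroSumW (α : ℝ) (n : ℕ) (x : WG) : ℝ :=
  ∑ j ∈ Finset.range n, Abin α (n - 1 - j) * walsh j x

@[fun_prop]
lemma continuous_cesaroSumW (n : ℕ) : Continuous (cesaroSumW α n) := by
  unfold cesaroSumW
  fun_prop

lemma cesaroSumW_two_pow_add {m i : ℕ} (h : i < 2 ^ m) (x : WG) :
    cesaroSumW α (2 ^ m + i) x =
      (Abin α (i + (2 ^ m - 1)) * dirPow m x + (-1) * blockRem α m i x) +
        rad m x * cesaroSumW α i x := by
  unfold cesaroSumW
  rw [Finset.sum_range_add, neg_one_mul, ← sub_eq_add_neg, ← sum_block_eq, Finset.mul_sum]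
  congr 1
  · refine Finset.sum_congr rfl fun k hk => ?_
    have hk := Finset.mem_range.1 hk
    rw [show 2 ^ m + i - 1 - k = i + (2 ^ m - 1 - k) by omega]
  · refine Finset.sum_congr rfl fun k hk => ?_
    have hk := Finset.mem_range.1 hk
    rw [walsh_two_pow_add (by omega), show 2 ^ m + i - 1 - (2 ^ m + k) = i - 1 - k by omega]
    ring

lemma l1_cesaroSumW_le (hα : 0 < α) (hα1 : α ≤ 1) (n : ℕ) :
    l1 (cesaroSumW α n) ≤ 3 * (2 / α + 1) * Abin α n := by
  induction n using Nat.strong_induction_on with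
  | _ n ih =>
  rcases eq_or_ne n 0 with rfl | hn
  · simp [l1, cesaroSumW, Abin_zero]
    positivity
  obtain ⟨m, i, hi, rfl⟩ := exists_two_pow_add hn
  have h1 := l1_blockRem_le hα hα1 m i
  have h2 := ih i (by omega)
  have hA : ∀ j, 0 < Abin α j := Abin_pos (by linarith)
  have h3 : Abin α (i + (2 ^ m - 1)) ≤ Abin α (2 ^ m + i) := Abin_monotone hα (by omega)
  have h4 : (1 + α / 2) * Abin α i ≤ Abin α (2 ^ m + i) :=
    (one_add_half_mul_Abin_le hα i).trans (Abin_monotone hα (by omega))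
  have h5 : 3 * Abin α (2 ^ m + i) + 3 * (2 / α + 1) * Abin α i ≤
      3 * (2 / α + 1) * Abin α (2 ^ m + i) := by
    have h6 := mul_le_mul_of_nonneg_left h4 (show 0 ≤ 6 / α by positivity)
    have e : 6 / α * ((1 + α / 2) * Abin α i) = 3 * (2 / α + 1) * Abin α i := by
      field_simp
      ring
    have e' : 3 * (2 / α + 1) * Abin α (2 ^ m + i) =
        6 / α * Abin α (2 ^ m + i) + 3 * Abin α (2 ^ m + i) := by ring
    linarith
  rw [funext (cesaroSumW_two_pow_add hi)]
  refine (l1_add_le (by fun_prop) (by fun_prop)).trans ?_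
  refine (add_le_add_left (l1_add_le (by fun_prop) (by fun_prop)) _).trans ?_
  rw [l1_const_mul, l1_dirPow, l1_mul_of_abs_eq_one (abs_rad m), l1_const_mul,
    abs_of_pos (hA _), abs_neg, abs_one]
  linarith [hA i]

/-- The part of the unnormalized Walsh–Kaczmarz Cesàro kernel of order `n` with frequencies
below `M`. -/
def cesaroSumK (α : ℝ) (n M : ℕ) (x : WG) : ℝ :=
  ∑ j ∈ Finset.range M, Abin α (n - 1 - j) * kacz j x

@[fun_prop]
lemma continuous_cesaroSumK (n M : ℕ) : Continuous (cesaroSumK α n M) := by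
  unfold cesaroSumK
  fun_prop

lemma KK_eq (α : ℝ) (n : ℕ) (x : WG) : KK α n x = (Abin α n)⁻¹ * cesaroSumK α n n x := by
  have key : ∀ n : ℕ, ∑ k ∈ Finset.range (n + 1), Abin (α - 1) (n - k) * dirK k x =
      cesaroSumK α n n x := by
    intro n
    simp only [cesaroSumK, dirK, Finset.mul_sum]
    rw [Finset.sum_comm' (t' := Finset.range n) (s' := fun j => Finset.Ico (j + 1) (n + 1))
      (by intro k j; simp only [Finset.mem_range, Finset.mem_Ico]; omega)]
    refine Finset.sum_congr rfl fun j hj => ?_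
    have hj := Finset.mem_range.1 hj
    rw [← Finset.sum_mul]
    congr 1
    obtain ⟨p, rfl⟩ : ∃ p, n = j + 1 + p := ⟨n - (j + 1), by omega⟩
    rw [Finset.sum_Ico_eq_sum_range, show j + 1 + p + 1 - (j + 1) = p + 1 by omega,
      ← Finset.sum_range_reflect, show j + 1 + p - 1 - j = p by omega]
    have h := sum_Abin_sub_one α 0 p
    simp only [zero_add, Abin_zero] at h
    rw [Finset.sum_range_succ', eq_add_of_sub_eq h.symm]
    congr 1
    · refine Finset.sum_congr rfl fun i hi => ?_
      have hi := Finset.mem_range.1 hi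
      congr 1
      omega
    · simp [Abin_zero]
  rw [KK, key]

lemma cesaroSumK_two_pow_succ {n m : ℕ} (h : 2 ^ (m + 1) ≤ n) (x : WG) :
    cesaroSumK α n (2 ^ (m + 1)) x = cesaroSumK α n (2 ^ m) x +
      rad m x * (Abin α (n - 1 - 2 ^ m) * dirPow m x -
        blockRem α m (n - 2 ^ (m + 1)) (tau m x)) := by
  have hpos : 0 < 2 ^ m := by positivity
  have e := sum_block_eq (α := α) m (n - 2 ^ (m + 1)) (tau m x)
  rw [pow_succ] at h e ⊢
  rw [dirPow_tau, show n - 2 ^ m * 2 + (2 ^ m - 1) = n - 1 - 2 ^ m by omega] at e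
  rw [← e, mul_two]
  unfold cesaroSumK
  rw [Finset.sum_range_add, Finset.mul_sum]
  congr 1
  refine Finset.sum_congr rfl fun k hk => ?_
  have hk := Finset.mem_range.1 hk
  rw [kacz_two_pow_add hk,
    show n - (2 ^ m + 2 ^ m) + (2 ^ m - 1 - k) = n - 1 - (2 ^ m + k) by omega]
  ring

lemma cesaroSumK_two_pow_add {m i : ℕ} (h : i < 2 ^ m) (x : WG) :
    cesaroSumK α (2 ^ m + i) (2 ^ m + i) x =
      cesaroSumK α (2 ^ m + i) (2 ^ m) x + rad m x * cesaroSumW α i (tau m x) := by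
  unfold cesaroSumK cesaroSumW
  rw [Finset.sum_range_add, Finset.mul_sum]
  congr 1
  refine Finset.sum_congr rfl fun k hk => ?_
  have hk := Finset.mem_range.1 hk
  rw [kacz_two_pow_add (by omega), show 2 ^ m + i - 1 - (2 ^ m + k) = i - 1 - k by omega]
  ring

lemma l1_cesaroSumK_sub_le (hα : 0 < α) (hα1 : α ≤ 1) {n m : ℕ} (h : 2 ^ m ≤ n) :
    l1 (fun x => cesaroSumK α n (2 ^ m) x - Abin α (n - 1 - 2 ^ m) * dirPow m x) ≤
      3 * (Abin α (n - 1) - Abin α (n - 1 - 2 ^ m)) := by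
  induction m with
  | zero =>
    have hd : 0 ≤ Abin α (n - 1) - Abin α (n - 1 - 1) :=
      sub_nonneg.2 (Abin_monotone hα (by omega))
    simp only [cesaroSumK, pow_zero, Finset.sum_range_one, kacz_zero, dirPow, Finset.range_zero,
      Finset.prod_empty, mul_one, Nat.sub_zero, l1_const, abs_of_nonneg hd]
    linarith
  | succ m ih =>
    have hpow : 2 ^ (m + 1) = 2 ^ m * 2 := pow_succ 2 m
    have hpos : 0 < 2 ^ m := by positivity
    have h1 := ih (by omega)
    set c := Abin α (n - 1 - 2 ^ m)
    set d := Abin α (n - 1 - 2 ^ (m + 1))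
    have hcd : 0 ≤ c - d := sub_nonneg.2 (Abin_monotone hα (by omega))
    have h2 := l1_blockRem_le hα hα1 m (n - 2 ^ (m + 1))
    rw [show n - 2 ^ (m + 1) + (2 ^ m - 1) = n - 1 - 2 ^ m by omega] at h2
    have h3 : d ≤ Abin α (n - 2 ^ (m + 1)) := Abin_monotone hα (by omega)
    have e : (fun x => cesaroSumK α n (2 ^ (m + 1)) x - d * dirPow (m + 1) x) = fun x =>
        ((cesaroSumK α n (2 ^ m) x - c * dirPow m x) + (c - d) * dirPow (m + 1) x) +
          (-1) * (rad m x * blockRem α m (n - 2 ^ (m + 1)) (tau m x)) := by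
      funext x
      rw [cesaroSumK_two_pow_succ h, dirPow_succ]
      ring
    have hc : Continuous fun x => blockRem α m (n - 2 ^ (m + 1)) (tau m x) :=
      (continuous_blockRem _ _).comp (continuous_tau m)
    rw [e]
    refine (l1_add_le (by fun_prop) (by fun_prop)).trans ?_
    refine (add_le_add_left (l1_add_le (by fun_prop) (by fun_prop)) _).trans ?_
    rw [l1_const_mul, l1_dirPow, l1_const_mul, l1_mul_of_abs_eq_one (abs_rad m),
      l1_comp_tau m (by fun_prop), abs_of_nonneg hcd, abs_neg, abs_one]
    linarith

lemma l1_cesaroSumK_two_pow_le (hα : 0 < α) (hα1 : α ≤ 1) {n m : ℕ} (h : 2 ^ m ≤ n) :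
    l1 (cesaroSumK α n (2 ^ m)) ≤ 3 * Abin α n := by
  have e : cesaroSumK α n (2 ^ m) = fun x =>
      (cesaroSumK α n (2 ^ m) x - Abin α (n - 1 - 2 ^ m) * dirPow m x) +
        Abin α (n - 1 - 2 ^ m) * dirPow m x := by
    funext x
    ring
  have h1 := l1_cesaroSumK_sub_le hα hα1 h
  have hpos := Abin_pos (β := α) (by linarith) (n - 1 - 2 ^ m)
  have hmono : Abin α (n - 1) ≤ Abin α n := Abin_monotone hα (by omega)
  rw [e]
  refine (l1_add_le (by fun_prop) (by fun_prop)).trans ?_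
  rw [l1_const_mul, l1_dirPow, abs_of_pos hpos]
  linarith

lemma l1_cesaroSumK_le (hα : 0 < α) (hα1 : α ≤ 1) (n : ℕ) :
    l1 (cesaroSumK α n n) ≤ (3 + 3 * (2 / α + 1)) * Abin α n := by
  have hA : ∀ j, 0 < Abin α j := Abin_pos (by linarith)
  rcases eq_or_ne n 0 with rfl | hn
  · simp [l1, cesaroSumK, Abin_zero]
    positivity
  obtain ⟨m, i, hi, rfl⟩ := exists_two_pow_add hn
  have h1 := l1_cesaroSumK_two_pow_le hα hα1 (Nat.le_add_right (2 ^ m) i)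
  have h2 := l1_cesaroSumW_le hα hα1 i
  have h3 := mul_le_mul_of_nonneg_left (Abin_monotone hα (Nat.le_add_left i (2 ^ m)))
    (show 0 ≤ 3 * (2 / α + 1) by positivity)
  have hc : Continuous fun x => cesaroSumW α i (tau m x) :=
    (continuous_cesaroSumW _).comp (continuous_tau m)
  rw [funext (cesaroSumK_two_pow_add hi)]
  refine (l1_add_le (by fun_prop) (by fun_prop)).trans ?_
  rw [l1_mul_of_abs_eq_one (abs_rad m), l1_comp_tau m (by fun_prop)]
  linarith

end Cesaro

/-- Simon: uniform boundedness of the `L¹`-norms of the one-dimensional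
Walsh–Kaczmarz `(C,α)` kernels, `sup_n ‖K_n^{κ,α}‖₁ < ∞`, for every `0 < α ≤ 1`. -/
theorem KK_L1_uniformly_bounded (α : ℝ) (hα : 0 < α) (hα1 : α ≤ 1) :
    ∃ C : ℝ, ∀ n : ℕ, ∫ x, |KK α n x| ∂ μW ≤ C := by
  refine ⟨3 + 3 * (2 / α + 1), fun n => ?_⟩
  have hA : 0 < Abin α n := Abin_pos (by linarith) n
  have h : ∫ x, |KK α n x| ∂μW = (Abin α n)⁻¹ * l1 (cesaroSumK α n n) := by
    rw [← abs_of_pos (inv_pos.2 hA), ← l1_const_mul]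
    simp only [l1, KK_eq]
  rw [h, inv_mul_le_iff₀ hA, mul_comm]
  exact l1_cesaroSumK_le hα hα1 n

end
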